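/- Theorem 1 (spinor type-1 Bishop equation): let φ : ℝ → ℂ² be differentiable with |φ₁(s)|² + |φ₂(s)|² = 1 for all s, let k₁, k₂ : ℝ → ℝ, and set N₁(s) = a(φ(s)), N₂(s) = b(φ(s)), T(s) = c(φ(s)). If the type-1 Bishop equations hold, i.e., T′(s) = k₁(s)·N₁(s) + k₂(s)·N₂(s), N₁′(s) = −k₁(s)·T(s) and N₂′(s) = −k₂(s)·T(s) for all s, then φ satisfies the single spinor equation φ′(s) = (1/2)·(k₁(s) + i·k₂(s))·φ̂(s) for all s. -/

import Mathlib

open Complex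

noncomputable section

/-- The mate (or conjugate) of a spinor `ψ = (ψ₁, ψ₂)` is `ψ̂ = (-conj ψ₂, conj ψ₁)`. -/
def mate (ψ : ℂ × ℂ) : ℂ × ℂ := (-(starRingEnd ℂ) ψ.2, (starRingEnd ℂ) ψ.1)

/-- The real vector `a(ψ) = (Re(ψ₁² - ψ₂²), -Im(ψ₁² + ψ₂²), -2 Re(ψ₁ψ₂))`. -/
def sa (ψ : ℂ × ℂ) : EuclideanSpace ℝ (Fin 3) :=
  !₂[(ψ.1 ^ 2 - ψ.2 ^ 2).re, -(ψ.1 ^ 2 + ψ.2 ^ 2).im, -2 * (ψ.1 * ψ.2).re]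

/-- The real vector `b(ψ) = (Im(ψ₁² - ψ₂²), Re(ψ₁² + ψ₂²), -2 Im(ψ₁ψ₂))`. -/
def sb (ψ : ℂ × ℂ) : EuclideanSpace ℝ (Fin 3) :=
  !₂[(ψ.1 ^ 2 - ψ.2 ^ 2).im, (ψ.1 ^ 2 + ψ.2 ^ 2).re, -2 * (ψ.1 * ψ.2).im]

/-- The real vector `c(ψ) = (2 Re(ψ₁ conj ψ₂), -2 Im(ψ₁ conj ψ₂), |ψ₁|² - |ψ₂|²)`. -/
def sc (ψ : ℂ × ℂ) : EuclideanSpace ℝ (Fin 3) :=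
  !₂[2 * (ψ.1 * (starRingEnd ℂ) ψ.2).re, -2 * (ψ.1 * (starRingEnd ℂ) ψ.2).im,
    ‖ψ.1‖ ^ 2 - ‖ψ.2‖ ^ 2]

/-- Reinterpret a plain vector in `Fin 3 → ℝ` as an element of Euclidean 3-space. -/
def toE (v : Fin 3 → ℝ) : EuclideanSpace ℝ (Fin 3) := WithLp.toLp 2 v


/-- Derivative of a curve in Euclidean 3-space given by its coordinates. -/
theorem hasDerivAt_vec3 {f g h : ℝ → ℝ} {df dg dh s : ℝ} (hf : HasDerivAt f df s)
    (hg : HasDerivAt g dg s) (hh : HasDerivAt h dh s) :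
    HasDerivAt (fun t => (!₂[f t, g t, h t] : EuclideanSpace ℝ (Fin 3))) !₂[df, dg, dh] s := by
  have h1 : HasDerivAt (fun t => (![f t, g t, h t] : Fin 3 → ℝ)) ![df, dg, dh] s := by
    rw [hasDerivAt_pi]
    intro i
    fin_cases i
    · exact hf
    · exact hg
    · exact hh
  exact ((EuclideanSpace.equiv (Fin 3) ℝ).symm.toContinuousLinearMap.hasFDerivAt).comp_hasDerivAt s h1

theorem HasDerivAt.c_re {f : ℝ → ℂ} {df : ℂ} {s : ℝ} (h : HasDerivAt f df s) :
    HasDerivAt (fun t => (f t).re) df.re s :=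
  (Complex.reCLM.hasFDerivAt).comp_hasDerivAt s h

theorem HasDerivAt.c_im {f : ℝ → ℂ} {df : ℂ} {s : ℝ} (h : HasDerivAt f df s) :
    HasDerivAt (fun t => (f t).im) df.im s :=
  (Complex.imCLM.hasFDerivAt).comp_hasDerivAt s h

/-- Theorem 1 (spinor type-1 Bishop equation): if the triad `N₁ = a(φ), N₂ = b(φ),
T = c(φ)` associated to a unit differentiable spinor field satisfies the type-1 Bishop
equations with Bishop curvatures `k₁, k₂`, then `φ' = (1/2)(k₁ + i k₂) φ̂`. -/
theorem spinor_type1_bishop_equation (φ : ℝ → ℂ × ℂ) (hφ : Differentiable ℝ φ)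
    (hunit : ∀ s, ‖(φ s).1‖ ^ 2 + ‖(φ s).2‖ ^ 2 = 1)
    (k₁ k₂ : ℝ → ℝ)
    (hT : ∀ s, deriv (fun t => sc (φ t)) s = k₁ s • sa (φ s) + k₂ s • sb (φ s))
    (hN₁ : ∀ s, deriv (fun t => sa (φ t)) s = (-k₁ s) • sc (φ s))
    (hN₂ : ∀ s, deriv (fun t => sb (φ t)) s = (-k₂ s) • sc (φ s)) :
    ∀ s, deriv φ s = ((1 : ℂ) / 2 * ((k₁ s : ℂ) + Complex.I * (k₂ s : ℂ))) • mate (φ s) := by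
  intro s
  have hd := (hφ s).hasDerivAt
  have hp : HasDerivAt (fun t => (φ t).1) (deriv φ s).1 s :=
    ((ContinuousLinearMap.fst ℝ ℂ ℂ).hasFDerivAt).comp_hasDerivAt s hd
  have hq : HasDerivAt (fun t => (φ t).2) (deriv φ s).2 s :=
    ((ContinuousLinearMap.snd ℝ ℂ ℂ).hasFDerivAt).comp_hasDerivAt s hd
  have hpp := hp.mul hp
  have hqq := hq.mul hq
  have hpq := hp.mul hq
  have hA := (hasDerivAt_vec3 (hpp.sub hqq).c_re (hpp.add hqq).c_im.neg
    (hpq.c_re.const_mul (-2))).deriv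
  have hB := (hasDerivAt_vec3 (hpp.sub hqq).c_im (hpp.add hqq).c_re
    (hpq.c_im.const_mul (-2))).deriv
  have eA := hN₁ s
  have eB := hN₂ s
  have hu := hunit s
  simp only [sa, sb, sc, sq (_ : ℂ)] at eA eB
  replace eA := hA.symm.trans eA
  replace eB := hB.symm.trans eB
  clear hA hB hT hN₁ hN₂
  have eA0 := congrArg (fun v : EuclideanSpace ℝ (Fin 3) => v 0) eA
  have eA1 := congrArg (fun v : EuclideanSpace ℝ (Fin 3) => v 1) eA
  have eA2 := congrArg (fun v : EuclideanSpace ℝ (Fin 3) => v 2) eA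
  have eB0 := congrArg (fun v : EuclideanSpace ℝ (Fin 3) => v 0) eB
  have eB1 := congrArg (fun v : EuclideanSpace ℝ (Fin 3) => v 1) eB
  have eB2 := congrArg (fun v : EuclideanSpace ℝ (Fin 3) => v 2) eB
  rw [Complex.sq_norm, Complex.sq_norm] at hu
  simp [Complex.sq_norm, Complex.normSq_apply] at eA0 eA1 eA2 eB0 eB1 eB2
  set p := (φ s).1 with hpdef
  set q := (φ s).2 with hqdef
  set x := (deriv φ s).1 with hxdef
  set y := (deriv φ s).2 with hydef
  set κ : ℂ := (1 : ℂ) / 2 * ((k₁ s : ℂ) + Complex.I * (k₂ s : ℂ)) with hκ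
  have κr : κ.re = k₁ s / 2 := by simp [hκ]; ring
  have κi : κ.im = k₂ s / 2 := by simp [hκ]; ring
  have E1 : p * (x + κ * (starRingEnd ℂ) q) = 0 := by
    apply Complex.ext <;> simp [κr, κi] <;> linarith
  have E2 : q * (y - κ * (starRingEnd ℂ) p) = 0 := by
    apply Complex.ext <;> simp [κr, κi] <;> linarith
  have E3 : q * (x + κ * (starRingEnd ℂ) q) + p * (y - κ * (starRingEnd ℂ) p) = 0 := by
    apply Complex.ext <;> simp [κr, κi] <;> linarith
  have X : x + κ * (starRingEnd ℂ) q = 0 ∧ y - κ * (starRingEnd ℂ) p = 0 := by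
    by_cases h0 : p = 0
    · have hq0 : q ≠ 0 := by
        intro h; rw [h0, h] at hu; simp at hu
      have h2 := (mul_eq_zero.mp E2).resolve_left hq0
      rw [h2, mul_zero, add_zero] at E3
      exact ⟨(mul_eq_zero.mp E3).resolve_left hq0, h2⟩
    · have h1 := (mul_eq_zero.mp E1).resolve_left h0
      rw [h1, mul_zero, zero_add] at E3
      exact ⟨h1, (mul_eq_zero.mp E3).resolve_left h0⟩
  apply Prod.ext
  · simp only [mate, Prod.smul_fst, smul_eq_mul]
    linear_combination X.1
  · simp only [mate, Prod.smul_snd, smul_eq_mul]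
    linear_combination X.2
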